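/- Let J be a real analytic almost complex structure on a neighborhood of 0 in ℝ^{2n} with J(0) = J₀, let M = {φ = 0} with 0 ∈ M, and let X be a real analytic vector field in a neighborhood of 0 lying in T^JM such that every vector field obtained from X by finitely many applications of J and of Lie brackets again lies in T^JM (i.e. the complex Lie algebra ℒ(X) generated by X and JX is contained in T^JM). Then there exists a sequence (X_k)_{k ≥ 1} of real analytic vector fields defined on a neighborhood of 0, each lying in T^JM, such that (a) D_{X_k}^{l,0}X_k(0) = D_X^{l,0}X(0) for all k ≥ 1 and all l ∈ ℕ, and (b) for every k ≥ 1, X_k commutes at order k at 0. -/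

import Mathlib

noncomputable section

open Metric

/-- `ℝ^{2n}` identified with `ℂ^n`. -/
abbrev Ecx (n : ℕ) := EuclideanSpace ℂ (Fin n)

/-- The standard complex structure `J₀` (multiplication by `i`), as a real-linear map. -/
def J0 (n : ℕ) : Ecx n →L[ℝ] Ecx n := Complex.I • ContinuousLinearMap.id ℝ (Ecx n)

variable {F : Type*} [NormedAddCommGroup F] [NormedSpace ℝ F]

/-- `J`-holomorphy of `γ` on a set `D ⊆ ℂ`: `dγ(ζ) ∘ J_st = J(γ ζ) ∘ dγ(ζ)`. -/
def JHolOn (J : F → F →L[ℝ] F) (D : Set ℂ) (γ : ℂ → F) : Prop :=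
  ∀ ζ ∈ D, ∀ v : ℂ, fderiv ℝ γ ζ (Complex.I * v) = J (γ ζ) (fderiv ℝ γ ζ v)


/-- Lie bracket of vector fields: `[X,Y](p) = dY(p)(X(p)) − dX(p)(Y(p))`. -/
def lieVF (X Y : F → F) : F → F :=
  fun p => fderiv ℝ Y p (X p) - fderiv ℝ X p (Y p)

/-- The vector field `JX : x ↦ J(x) X(x)`. -/
def Jvf (J : F → F →L[ℝ] F) (X : F → F) : F → F := fun p => J p (X p)

/-- The flat covariant derivative `X · Y : p ↦ dY(p)(X(p))`. -/
def derVF (X Y : F → F) : F → F := fun p => fderiv ℝ Y p (X p)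

/-- `DX X Y k = D_X^{k,0} Y = X·(X·(⋯(X·Y)))` (`k` times). -/
def DX (X Y : F → F) : ℕ → (F → F)
  | 0 => Y
  | k + 1 => derVF X (DX X Y k)

/-- `applyVF [X₁,…,X_k] Z = X₁·(X₂·(⋯(X_k·Z)))`. -/
def applyVF : List (F → F) → (F → F) → (F → F)
  | [], Z => Z
  | Y :: rest, Z => derVF Y (applyVF rest Z)

/-- `nestedLie [X₁,…,X_k] Z = [X₁,[X₂,[…,[X_k, Z]…]]]`. -/
def nestedLie : List (F → F) → (F → F) → (F → F)
  | [], Z => Z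
  | Y :: rest, Z => lieVF Y (nestedLie rest Z)

/-- Selector for elements of `{X, JX}`: `pickVF X JX true = X`, `pickVF X JX false = JX`. -/
def pickVF (X Y : F → F) (b : Bool) : F → F := if b then X else Y

/-- `X` commutes at order `k` at `p`: all iterated Lie brackets of length `l` with
`2 ≤ l ≤ k` of elements of `{X, JX}` vanish at `p`. -/
def CommutesAtOrder (J : F → F →L[ℝ] F) (X : F → F) (k : ℕ) (p : F) : Prop :=
  ∀ m : ℕ, 1 ≤ m → m + 1 ≤ k → ∀ b : Fin m → Bool, ∀ c : Bool,
    nestedLie (List.ofFn fun i => pickVF X (Jvf J X) (b i))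
      (pickVF X (Jvf J X) c) p = 0


/-- A vector field lies in `T^J M` (with `M = {φ = 0}` inside `U`). -/
def InTJM (J : F → F →L[ℝ] F) (φ : F → ℝ) (U : Set F) (X : F → F) : Prop :=
  ∀ q ∈ U, φ q = 0 → fderiv ℝ φ q (X q) = 0 ∧ fderiv ℝ φ q (J q (X q)) = 0

/-- The complex Lie algebra `ℒ(X)` generated by `X`: the vector fields obtained from `X`
by finitely many applications of `J` and of Lie brackets. -/
inductive LieGen (J : F → F →L[ℝ] F) (X : F → F) : (F → F) → Prop
  | base : LieGen J X X
  | jmul {Y : F → F} : LieGen J X Y → LieGen J X (Jvf J Y)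
  | bracket {Y Z : F → F} : LieGen J X Y → LieGen J X Z → LieGen J X (lieVF Y Z)

open scoped Topology ContDiff

section Superposition

variable {K E : Type*} [TopologicalSpace K] [CompactSpace K]
  [NormedAddCommGroup E] [NormedSpace ℝ E]

/-- The pointwise action of a continuous multilinear map on continuous functions. -/
def pointwiseMultilinear {n : ℕ} (p : ContinuousMultilinearMap ℝ (fun _ : Fin n => E) E) :
    ContinuousMultilinearMap ℝ (fun _ : Fin n => C(K, E)) C(K, E) :=
  MultilinearMap.mkContinuous
    { toFun := fun u => ⟨fun x => p fun i => u i x, by fun_prop⟩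
      map_update_add' := by
        intro _ u i a b
        ext x
        have key : ∀ c : C(K, E), (fun j => Function.update u i c j x)
            = Function.update (fun j => u j x) i (c x) := by
          intro c
          ext j
          by_cases h : j = i
          · subst h; simp
          · simp [h]
        convert p.map_update_add (fun j => u j x) i (a x) (b x) using 1
        · simp only [ContinuousMap.coe_mk]
          congr 1
          convert key (a + b)
          simp
        · simp only [ContinuousMap.add_apply, ContinuousMap.coe_mk]
          congr 2
          · convert key a
          · convert key b
      map_update_smul' := by
        intro _ u i c a
        ext x
        have key : ∀ c : C(K, E), (fun j => Function.update u i c j x)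
            = Function.update (fun j => u j x) i (c x) := by
          intro c
          ext j
          by_cases h : j = i
          · subst h; simp
          · simp [h]
        convert p.map_update_smul (fun j => u j x) i c (a x) using 1
        · simp only [ContinuousMap.coe_mk]
          congr 1
          convert key (c • a)
          simp
        · simp only [ContinuousMap.smul_apply, ContinuousMap.coe_mk]
          congr 2
          convert key a }
    ‖p‖ (by
      intro u
      refine (ContinuousMap.norm_le _ (by positivity)).2 fun x => ?_
      refine (p.le_opNorm _).trans ?_
      gcongr with i
      exact ContinuousMap.norm_coe_le_norm _ _)

lemma norm_pointwiseMultilinear_le {n : ℕ}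
    (p : ContinuousMultilinearMap ℝ (fun _ : Fin n => E) E) :
    ‖(pointwiseMultilinear p : ContinuousMultilinearMap ℝ (fun _ : Fin n => C(K, E)) C(K, E))‖
      ≤ ‖p‖ :=
  MultilinearMap.mkContinuous_norm_le _ (norm_nonneg _) _

/-- Composition with a map analytic at `0` is analytic near `0` on spaces of continuous functions. -/
lemma exists_analyticAt_superposition [CompleteSpace E] {f : E → E} (hf : AnalyticAt ℝ f 0) :
    ∃ S : C(K, E) → C(K, E), AnalyticAt ℝ S 0 ∧
      ∀ᶠ u in 𝓝 (0 : C(K, E)), ∀ x, S u x = f (u x) := by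
  obtain ⟨p, r, hp⟩ := hf
  let P : FormalMultilinearSeries ℝ C(K, E) C(K, E) := fun n => pointwiseMultilinear (p n)
  have hrad : r ≤ P.radius := by
    refine hp.r_le.trans (ENNReal.le_of_forall_nnreal_lt fun s hs => ?_)
    obtain ⟨C, -, hC⟩ := p.norm_mul_pow_le_of_lt_radius hs
    refine P.le_radius_of_bound C fun n => le_trans ?_ (hC n)
    gcongr
    exact norm_pointwiseMultilinear_le _
  have hP := P.hasFPowerSeriesOnBall (hp.r_pos.trans_le hrad)
  refine ⟨P.sum, hP.analyticAt, ?_⟩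
  filter_upwards [Metric.eball_mem_nhds (0 : C(K, E)) hp.r_pos] with u hu x
  have h1 := hP.hasSum (Metric.eball_subset_eball hrad hu)
  have h2 := h1.mapL (ContinuousMap.evalCLM ℝ x : C(K, E) →L[ℝ] E)
  have hux : u x ∈ Metric.eball (0 : E) r := by
    simp only [Metric.mem_eball, edist_zero_right] at hu ⊢
    refine lt_of_le_of_lt ?_ hu
    rw [enorm_le_iff_norm_le]
    exact ContinuousMap.norm_coe_le_norm _ _
  have h3 := hp.hasSum hux
  simp only [zero_add] at h2 h3
  exact h2.unique h3

/-- The Volterra operator `u ↦ (t ↦ ∫₀ᵗ u)` on `C([0,1], E)`. -/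
def volterra (E : Type*) [NormedAddCommGroup E] [NormedSpace ℝ E] :
    C(Set.Icc (0 : ℝ) 1, E) →L[ℝ] C(Set.Icc (0 : ℝ) 1, E) :=
  LinearMap.mkContinuous
    { toFun := fun u => ⟨fun t => ∫ s in (0 : ℝ)..t, Set.IccExtend zero_le_one u s, by
        refine (intervalIntegral.continuous_primitive (fun a b => ?_) 0).comp
          continuous_subtype_val
        exact (u.continuous.Icc_extend').intervalIntegrable _ _⟩
      map_add' := by
        intro u v
        ext t
        simp only [ContinuousMap.coe_mk, ContinuousMap.add_apply]
        rw [← intervalIntegral.integral_add]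
        · rfl
        · exact (u.continuous.Icc_extend').intervalIntegrable _ _
        · exact (v.continuous.Icc_extend').intervalIntegrable _ _
      map_smul' := by
        intro c u
        ext t
        simp only [ContinuousMap.coe_mk, ContinuousMap.smul_apply, RingHom.id_apply]
        rw [← intervalIntegral.integral_smul]
        rfl }
    1 (by
      intro u
      refine (ContinuousMap.norm_le _ (by positivity)).2 fun t => ?_
      have := intervalIntegral.norm_integral_le_of_norm_le_const (a := (0 : ℝ)) (b := t)
        (f := Set.IccExtend zero_le_one u) (C := ‖u‖)
        (fun s _ => ContinuousMap.norm_coe_le_norm _ _)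
      refine this.trans ?_
      rw [sub_zero, abs_of_nonneg t.2.1, mul_comm]
      gcongr
      exact t.2.2)

lemma volterra_apply (u : C(Set.Icc (0 : ℝ) 1, E)) (t : Set.Icc (0 : ℝ) 1) :
    volterra E u t = ∫ s in (0 : ℝ)..t, Set.IccExtend zero_le_one u s := rfl

end Superposition

/-- An integral curve of an analytic vector field is analytic. -/
lemma analyticAt_of_hasDerivAt_autonomous {E : Type*} [NormedAddCommGroup E] [NormedSpace ℝ E]
    [CompleteSpace E] {f : E → E} (hf : AnalyticAt ℝ f 0) {γ : ℝ → E} (h0 : γ 0 = 0)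
    (hγ : ∀ᶠ t in 𝓝 0, HasDerivAt γ (f (γ t)) t) : AnalyticAt ℝ γ 0 := by
  obtain ⟨S, hS, hSf⟩ := exists_analyticAt_superposition (K := Set.Icc (0 : ℝ) 1) hf
  let Φ : ℝ × C(Set.Icc (0 : ℝ) 1, E) → C(Set.Icc (0 : ℝ) 1, E) :=
    fun v => v.2 - v.1 • volterra E (S v.2)
  have hΦ : ContDiffAt ℝ ω Φ (0, 0) := by
    have : AnalyticAt ℝ Φ (0, 0) := by
      refine analyticAt_snd.sub (analyticAt_fst.smul ?_)
      refine ((volterra E).analyticAt _).comp ?_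
      exact AnalyticAt.fun_comp (g := S) (by exact hS) analyticAt_snd
    exact this.contDiffAt
  have hinv : fderiv ℝ Φ (0, 0) ∘L .inr ℝ ℝ C(Set.Icc (0 : ℝ) 1, E)
      = ContinuousLinearMap.id ℝ _ := by
    have h1 : HasFDerivAt (fun u => Φ (0, u))
        (fderiv ℝ Φ (0, 0) ∘L .inr ℝ ℝ C(Set.Icc (0 : ℝ) 1, E)) 0 :=
      (hΦ.differentiableAt (by simp)).hasFDerivAt.comp (0 : C(Set.Icc (0 : ℝ) 1, E))
        (hasFDerivAt_prodMk_right (0 : ℝ) (0 : C(Set.Icc (0 : ℝ) 1, E)))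
    have h2 : (fun u => Φ (0, u)) = id := by
      ext u : 1
      simp [Φ]
    rw [h2] at h1
    exact h1.unique (hasFDerivAt_id _)
  have hi : (fderiv ℝ Φ (0, 0) ∘L .inr ℝ ℝ C(Set.Icc (0 : ℝ) 1, E)).IsInvertible := by
    rw [hinv]
    exact ⟨ContinuousLinearEquiv.refl ℝ _, rfl⟩
  have hψ := hΦ.contDiffAt_implicitFunction (by simp) hi
  have hiff := hΦ.eventually_apply_eq_iff_implicitFunction (by simp) hi
  set ψ := hΦ.implicitFunction (by simp) hi
  obtain ⟨δ, hδ, hball⟩ := Metric.eventually_nhds_iff_ball.1 hγ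
  -- a globally continuous curve that agrees with `γ` near `0`
  let g : ℝ → E := Set.IccExtend (show -(δ / 2) ≤ δ / 2 by linarith)
    (fun t : Set.Icc (-(δ / 2)) (δ / 2) => γ t)
  have hmem : ∀ t ∈ Set.Icc (-(δ / 2)) (δ / 2), t ∈ Metric.ball (0 : ℝ) δ := by
    intro t ht
    rw [Metric.mem_ball, dist_zero_right, Real.norm_eq_abs, abs_lt]
    constructor <;> linarith [ht.1, ht.2]
  have hgc : Continuous g := by
    refine Continuous.Icc_extend' (continuous_iff_continuousAt.2 fun t => ?_)
    exact (hball t (hmem t t.2)).continuousAt.comp continuous_subtype_val.continuousAt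
  have hgγ : ∀ t ∈ Set.Icc (-(δ / 2)) (δ / 2), g t = γ t := fun t ht =>
    Set.IccExtend_of_mem _ _ ht
  have hg0 : g 0 = 0 := by rw [hgγ 0 ⟨by linarith, by linarith⟩, h0]
  let G : C(ℝ, C(Set.Icc (0 : ℝ) 1, E)) :=
    ContinuousMap.curry ⟨fun q : ℝ × Set.Icc (0 : ℝ) 1 => g (q.1 * q.2), by fun_prop⟩
  have hG : ∀ ε t, G ε t = g (ε * t) := fun _ _ => rfl
  have hG0 : G 0 = 0 := by
    ext t
    simp [hG, hg0]
  have hGt : Filter.Tendsto (fun ε => (ε, G ε)) (𝓝 0) (𝓝 (0, 0)) := by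
    have : Continuous fun ε => (ε, G ε) := by fun_prop
    convert this.tendsto 0
    exact hG0.symm
  have hGt' : Filter.Tendsto G (𝓝 0) (𝓝 0) := by
    have := G.continuous.tendsto 0
    rwa [hG0] at this
  have heq : ∀ᶠ ε in 𝓝 (0 : ℝ), Φ (ε, G ε) = 0 := by
    filter_upwards [hGt'.eventually hSf, Metric.ball_mem_nhds (0 : ℝ) (half_pos hδ)] with ε hε hεδ
    have hsmall : ∀ s ∈ Set.Icc (0 : ℝ) 1, ε * s ∈ Set.Icc (-(δ / 2)) (δ / 2) := by
      intro s hs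
      rw [Metric.mem_ball, dist_zero_right, Real.norm_eq_abs] at hεδ
      rw [Set.mem_Icc, ← abs_le, abs_mul, abs_of_nonneg hs.1]
      nlinarith [abs_nonneg ε, hs.2, hs.1]
    ext t
    simp only [Φ, ContinuousMap.sub_apply, ContinuousMap.smul_apply, ContinuousMap.zero_apply,
      volterra_apply, hG]
    have hderiv : ∀ s ∈ Set.uIcc (0 : ℝ) t, HasDerivAt (fun s => γ (ε * s))
        (ε • Set.IccExtend zero_le_one (S (G ε)) s) s := by
      intro s hs
      rw [Set.uIcc_of_le t.2.1] at hs
      have hs1 : s ∈ Set.Icc (0 : ℝ) 1 := ⟨hs.1, hs.2.trans t.2.2⟩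
      rw [Set.IccExtend_of_mem _ _ hs1, hε, hG, hgγ _ (hsmall s hs1)]
      have h1 := hball _ (hmem _ (hsmall s hs1))
      have h2 : HasDerivAt (fun s => ε * s) ε s := by
        simpa using (hasDerivAt_id s).const_mul ε
      exact h1.scomp s h2
    have hint := intervalIntegral.integral_eq_sub_of_hasDerivAt hderiv
      (Continuous.intervalIntegrable
        (((S (G ε)).continuous.Icc_extend').const_smul ε) _ _)
    rw [intervalIntegral.integral_smul] at hint
    rw [hint, hgγ _ (hsmall t t.2), mul_zero, h0, sub_zero, sub_self]
  have hψG : ∀ᶠ ε in 𝓝 (0 : ℝ), ψ ε = G ε := by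
    filter_upwards [hGt.eventually hiff, heq] with ε h1 h2
    refine h1.1 ?_
    rw [h2]
    simp [Φ]
  have hψa : AnalyticAt ℝ ψ 0 := hψ.analyticAt
  have hev : AnalyticAt ℝ (fun ε => (ContinuousMap.evalCLM ℝ (1 : Set.Icc (0 : ℝ) 1) :
      C(Set.Icc (0 : ℝ) 1, E) →L[ℝ] E) (ψ ε)) 0 :=
    ((ContinuousMap.evalCLM ℝ (1 : Set.Icc (0 : ℝ) 1) :
      C(Set.Icc (0 : ℝ) 1, E) →L[ℝ] E).analyticAt _).comp hψa
  refine hev.congr ?_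
  filter_upwards [hψG, Icc_mem_nhds (show -(δ / 2) < 0 by linarith) (half_pos hδ)] with ε h1 h2
  rw [h1, ContinuousMap.evalCLM_apply, hG]
  simp [hgγ ε h2]

section VanishingOrder

open Filter

set_option linter.unusedSectionVars false

variable {E G G₁ G₂ G₃ : Type*} [NormedAddCommGroup E] [NormedSpace ℝ E]
  [NormedAddCommGroup G] [NormedSpace ℝ G]
  [NormedAddCommGroup G₁] [NormedSpace ℝ G₁] [NormedAddCommGroup G₂] [NormedSpace ℝ G₂]
  [NormedAddCommGroup G₃] [NormedSpace ℝ G₃]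

lemma AnalyticAt.bilin (B : G₁ →L[ℝ] G₂ →L[ℝ] G₃) {f : E → G₁} {g : E → G₂} {p : E}
    (hf : AnalyticAt ℝ f p) (hg : AnalyticAt ℝ g p) :
    AnalyticAt ℝ (fun x => B (f x) (g x)) p :=
  (B.analyticAt_bilinear (f p, g p)).comp₂ hf hg

lemma AnalyticAt.clm_eval {A : E → G₁ →L[ℝ] G₂} {g : E → G₁} {p : E}
    (hA : AnalyticAt ℝ A p) (hg : AnalyticAt ℝ g p) : AnalyticAt ℝ (fun x => A x (g x)) p :=
  AnalyticAt.bilin (ContinuousLinearMap.id ℝ (G₁ →L[ℝ] G₂)) hA hg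

variable [CompleteSpace G] [CompleteSpace G₁] [CompleteSpace G₂] [CompleteSpace G₃]

/-- The derivative of `g` along the vector field `Y`. -/
def along (Y : E → E) (g : E → G) : E → G := fun p => fderiv ℝ g p (Y p)

/-- `alongs [Y₁, …, Y_k] g = Y₁ · (Y₂ · (⋯ (Y_k · g)))`. -/
def alongs : List (E → E) → (E → G) → (E → G)
  | [], g => g
  | Y :: l, g => along Y (alongs l g)

/-- `g` is analytic at `0` and vanishes there to order `k`: all derivatives of `g` at `0` along
fewer than `k` analytic vector fields are zero. -/
def VanishOrd : ℕ → (E → G) → Prop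
  | 0, g => AnalyticAt ℝ g 0
  | k + 1, g => AnalyticAt ℝ g 0 ∧ g 0 = 0 ∧
      ∀ Y : E → E, AnalyticAt ℝ Y 0 → VanishOrd k (along Y g)

lemma AnalyticAt.along {Y : E → E} {g : E → G} {p : E}
    (hY : AnalyticAt ℝ Y p) (hg : AnalyticAt ℝ g p) : AnalyticAt ℝ (along Y g) p :=
  hg.fderiv.clm_eval hY

lemma Filter.EventuallyEq.along {Y : E → E} {g g' : E → G} (h : g =ᶠ[𝓝 0] g') :
    along Y g =ᶠ[𝓝 0] along Y g' := by
  filter_upwards [h.fderiv (𝕜 := ℝ)] with p hp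
  simp [_root_.along, hp]

lemma along_add_eventuallyEq {Y : E → E} {g g' : E → G} (hg : AnalyticAt ℝ g 0)
    (hg' : AnalyticAt ℝ g' 0) : along Y (g + g') =ᶠ[𝓝 0] along Y g + along Y g' := by
  filter_upwards [hg.eventually_analyticAt, hg'.eventually_analyticAt] with p h h'
  simp [along, fderiv_add h.differentiableAt h'.differentiableAt]

lemma along_neg (Y : E → E) (g : E → G) : along Y (-g) = -along Y g := by
  ext p
  simp [along, fderiv_neg]

lemma along_bilin_eventuallyEq (B : G₁ →L[ℝ] G₂ →L[ℝ] G₃) {Y : E → E} {f : E → G₁} {g : E → G₂}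
    (hf : AnalyticAt ℝ f 0) (hg : AnalyticAt ℝ g 0) :
    along Y (fun x => B (f x) (g x)) =ᶠ[𝓝 0]
      (fun x => B (f x) (along Y g x)) + fun x => B (along Y f x) (g x) := by
  filter_upwards [hf.eventually_analyticAt, hg.eventually_analyticAt] with p h h'
  have := B.hasFDerivAt_of_bilinear h.differentiableAt.hasFDerivAt h'.differentiableAt.hasFDerivAt
  simp [along, this.fderiv]

lemma VanishOrd.analyticAt {k : ℕ} {g : E → G} (h : VanishOrd k g) : AnalyticAt ℝ g 0 := by
  cases k with
  | zero => exact h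
  | succ k => exact h.1

lemma VanishOrd.apply_zero {k : ℕ} {g : E → G} (h : VanishOrd k g) (hk : 1 ≤ k) : g 0 = 0 := by
  cases k with
  | zero => omega
  | succ k => exact h.2.1

lemma VanishOrd.congr {k : ℕ} {g g' : E → G} (h : VanishOrd k g) (he : g =ᶠ[𝓝 0] g') :
    VanishOrd k g' := by
  induction k generalizing g g' with
  | zero => exact AnalyticAt.congr h he
  | succ k ih =>
    exact ⟨h.1.congr he, he.eq_of_nhds ▸ h.2.1, fun Y hY => ih (h.2.2 Y hY) he.along⟩

lemma VanishOrd.neg {k : ℕ} {g : E → G} (h : VanishOrd k g) : VanishOrd k (-g) := by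
  induction k generalizing g with
  | zero => exact AnalyticAt.neg h
  | succ k ih =>
    exact ⟨h.1.neg, by simp [h.2.1], fun Y hY => along_neg Y g ▸ ih (h.2.2 Y hY)⟩

lemma VanishOrd.add {k : ℕ} {g g' : E → G} (h : VanishOrd k g) (h' : VanishOrd k g') :
    VanishOrd k (g + g') := by
  induction k generalizing g g' with
  | zero => exact AnalyticAt.add h h'
  | succ k ih =>
    exact ⟨h.1.add h'.1, by simp [h.2.1, h'.2.1], fun Y hY =>
      (ih (h.2.2 Y hY) (h'.2.2 Y hY)).congr (along_add_eventuallyEq h.1 h'.1).symm⟩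

lemma VanishOrd.sub {k : ℕ} {g g' : E → G} (h : VanishOrd k g) (h' : VanishOrd k g') :
    VanishOrd k (g - g') := sub_eq_add_neg g g' ▸ h.add h'.neg

lemma VanishOrd.of_succ {k : ℕ} {g : E → G} (h : VanishOrd (k + 1) g) :
    VanishOrd k g := by
  induction k generalizing g with
  | zero => exact h.1
  | succ k ih => exact ⟨h.1, h.2.1, fun Y hY => ih (h.2.2 Y hY)⟩

lemma VanishOrd.mono {k m : ℕ} {g : E → G} (h : VanishOrd k g) (hm : m ≤ k) :
    VanishOrd m g := by
  induction k, hm using Nat.le_induction with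
  | base => exact h
  | succ k _ ih => exact ih h.of_succ

lemma vanishOrd_zero (k : ℕ) : VanishOrd k (0 : E → G) := by
  induction k with
  | zero => exact analyticAt_const
  | succ k ih =>
    refine ⟨analyticAt_const, rfl, fun Y _ => ?_⟩
    convert ih
    ext p
    simp [along]

lemma VanishOrd.along {k : ℕ} {g : E → G} (h : VanishOrd k g) {Y : E → E}
    (hY : AnalyticAt ℝ Y 0) : VanishOrd (k - 1) (along Y g) := by
  cases k with
  | zero => exact AnalyticAt.along hY h
  | succ k => exact h.2.2 Y hY

lemma VanishOrd.bilin 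
    (B : G₁ →L[ℝ] G₂ →L[ℝ] G₃) {i j m : ℕ} {f : E → G₁} {g : E → G₂}
    (hf : VanishOrd i f) (hg : VanishOrd j g) (hm : m ≤ i + j) :
    VanishOrd m (fun x => B (f x) (g x)) := by
  induction m generalizing i j f g with
  | zero => exact AnalyticAt.bilin B hf.analyticAt hg.analyticAt
  | succ m ih =>
    refine ⟨AnalyticAt.bilin B hf.analyticAt hg.analyticAt, ?_, fun Y hY => ?_⟩
    · rcases Nat.eq_zero_or_pos i with hi | hi
      · simp [hg.apply_zero (by omega)]
      · simp [hf.apply_zero hi]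
    · refine VanishOrd.congr ?_ (along_bilin_eventuallyEq B hf.analyticAt hg.analyticAt).symm
      exact (ih hf (hg.along hY) (by omega)).add (ih (hf.along hY) hg (by omega))

lemma VanishOrd.clm_eval {i j m : ℕ}
    {A : E → G₁ →L[ℝ] G₂} {g : E → G₁} (hA : VanishOrd i A) (hg : VanishOrd j g)
    (hm : m ≤ i + j) : VanishOrd m (fun x => A x (g x)) :=
  hA.bilin (ContinuousLinearMap.id ℝ (G₁ →L[ℝ] G₂)) hg hm

lemma VanishOrd.smul {i j m : ℕ} {f : E → ℝ} {g : E → G}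
    (hf : VanishOrd i f) (hg : VanishOrd j g) (hm : m ≤ i + j) : VanishOrd m (f • g) :=
  hf.bilin (ContinuousLinearMap.lsmul ℝ ℝ) hg hm

lemma VanishOrd.const_smul {j : ℕ} {g : E → G} (hg : VanishOrd j g) (c : ℝ) :
    VanishOrd j (c • g) :=
  VanishOrd.smul (i := 0) (f := fun _ => c) analyticAt_const hg (by omega)

lemma vanishOrd_one {g : E → G} (hg : AnalyticAt ℝ g 0) (h0 : g 0 = 0) :
    VanishOrd 1 g := ⟨hg, h0, fun _ hY => AnalyticAt.along hY hg⟩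

lemma VanishOrd.pow {f : E → ℝ} (hf : VanishOrd 1 f) (a : ℕ) : VanishOrd a (f ^ a) := by
  induction a with
  | zero =>
    rw [pow_zero]
    exact (analyticAt_const : AnalyticAt ℝ (fun _ : E => (1 : ℝ)) 0)
  | succ a ih => exact pow_succ f a ▸ ih.smul hf le_rfl

lemma alongs_append (l l' : List (E → E)) (g : E → G) :
    alongs (l ++ l') g = alongs l (alongs l' g) := by
  induction l with
  | nil => rfl
  | cons Y l ih => simp [alongs, ih]

lemma AnalyticAt.alongs {l : List (E → E)} (hl : ∀ Y ∈ l, AnalyticAt ℝ Y 0)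
    {g : E → G} (hg : AnalyticAt ℝ g 0) : AnalyticAt ℝ (alongs l g) 0 := by
  induction l with
  | nil => exact hg
  | cons Y l ih =>
    rw [List.forall_mem_cons] at hl
    exact AnalyticAt.along hl.1 (ih hl.2)

lemma Filter.EventuallyEq.alongs {g g' : E → G} (h : g =ᶠ[𝓝 0] g') (l : List (E → E)) :
    alongs l g =ᶠ[𝓝 0] alongs l g' := by
  induction l with
  | nil => exact h
  | cons Y l ih => exact ih.along

lemma alongs_add_eventuallyEq {l : List (E → E)}
    (hl : ∀ Y ∈ l, AnalyticAt ℝ Y 0) {g g' : E → G} (hg : AnalyticAt ℝ g 0)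
    (hg' : AnalyticAt ℝ g' 0) : alongs l (g + g') =ᶠ[𝓝 0] alongs l g + alongs l g' := by
  induction l with
  | nil => rfl
  | cons Y l ih =>
    rw [List.forall_mem_cons] at hl
    exact (ih hl.2).along.trans (along_add_eventuallyEq (hg.alongs hl.2) (hg'.alongs hl.2))

lemma alongs_neg (l : List (E → E)) (g : E → G) : alongs l (-g) = -alongs l g := by
  induction l with
  | nil => rfl
  | cons Y l ih => simp [alongs, ih, along_neg]

lemma alongs_sub_eventuallyEq {l : List (E → E)}
    (hl : ∀ Y ∈ l, AnalyticAt ℝ Y 0) {g g' : E → G} (hg : AnalyticAt ℝ g 0)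
    (hg' : AnalyticAt ℝ g' 0) : alongs l (g - g') =ᶠ[𝓝 0] alongs l g - alongs l g' := by
  simpa [sub_eq_add_neg, alongs_neg] using alongs_add_eventuallyEq hl hg hg'.neg

lemma VanishOrd.alongs {k : ℕ} {g : E → G} (h : VanishOrd k g)
    {l : List (E → E)} (hl : ∀ Y ∈ l, AnalyticAt ℝ Y 0) :
    VanishOrd (k - l.length) (alongs l g) := by
  induction l with
  | nil => exact h
  | cons Y l ih =>
    rw [List.forall_mem_cons] at hl
    have := (ih hl.2).along hl.1
    rw [Nat.sub_sub] at this
    exact this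

lemma VanishOrd.alongs_apply_zero {k : ℕ} {g : E → G} (h : VanishOrd k g)
    {l : List (E → E)} (hl : ∀ Y ∈ l, AnalyticAt ℝ Y 0) (hk : l.length < k) :
    _root_.alongs l g 0 = 0 :=
  (h.alongs hl).apply_zero (by omega)

lemma along_smul_eventuallyEq {Y : E → E} {f : E → ℝ} {g : E → G}
    (hf : AnalyticAt ℝ f 0) (hg : AnalyticAt ℝ g 0) :
    along Y (f • g) =ᶠ[𝓝 0] f • along Y g + along Y f • g :=
  along_bilin_eventuallyEq (ContinuousLinearMap.lsmul ℝ ℝ) hf hg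

lemma alongs_smul_apply_zero {l : List (E → E)}
    (hl : ∀ Y ∈ l, AnalyticAt ℝ Y 0) {f : E → ℝ} {g : E → G}
    (hf : VanishOrd l.length f) (hg : AnalyticAt ℝ g 0) :
    alongs l (f • g) 0 = alongs l f 0 • g 0 := by
  induction l using List.reverseRecOn generalizing f with
  | nil => rfl
  | append_singleton l Y ih =>
    simp only [List.mem_append, List.mem_singleton] at hl
    have hY := hl Y (Or.inr rfl)
    have hl' : ∀ Z ∈ l, AnalyticAt ℝ Z 0 := fun Z hZ => hl Z (Or.inl hZ)
    simp only [List.length_append, List.length_singleton] at hf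
    rw [alongs_append, alongs_append]
    change alongs l (along Y (f • g)) 0 = alongs l (along Y f) 0 • g 0
    rw [← ih hl' (hf.along hY),
      ((along_smul_eventuallyEq hf.analyticAt hg).alongs l).eq_of_nhds,
      (alongs_add_eventuallyEq hl' (hf.analyticAt.smul (AnalyticAt.along hY hg))
        ((AnalyticAt.along hY hf.analyticAt).smul hg)).eq_of_nhds, Pi.add_apply,
      (hf.smul (j := 0) (AnalyticAt.along hY hg) le_rfl).alongs_apply_zero hl' (by omega), zero_add]

lemma alongs_const_smul (l : List (E → E)) (c : ℝ) (g : E → G) :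
    alongs l (c • g) = c • alongs l g := by
  induction l with
  | nil => rfl
  | cons Y l ih =>
    ext p
    simp [alongs, ih, along, fderiv_const_smul_field]

/-- The top order derivatives at `0` of a monomial `s ^ a * y ^ b` along words in the two vector
fields `P true`, `P false` dual to `s`, `y`. -/
lemma alongs_monomial_apply_zero {P : Bool → E → E} (hP : ∀ b, AnalyticAt ℝ (P b) 0)
    {s y : E → ℝ} (hs : VanishOrd 1 s) (hy : VanishOrd 1 y)
    (hst : along (P true) s 0 = 1) (hsf : along (P false) s 0 = 0)
    (hyt : along (P true) y 0 = 0) (hyf : along (P false) y 0 = 1)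
    (l : List Bool) (a b : ℕ) (hl : l.length = a + b) :
    alongs (l.map P) (s ^ a • y ^ b) 0 =
      if l.count true = a then (a.factorial * b.factorial : ℝ) else 0 := by
  induction l using List.reverseRecOn generalizing a b with
  | nil =>
    obtain ⟨rfl, rfl⟩ : a = 0 ∧ b = 0 := by simpa using hl.symm
    simp [alongs]
  | append_singleton l c ih =>
    simp only [List.length_append, List.length_singleton] at hl
    have hl' : ∀ Y ∈ l.map P, AnalyticAt ℝ Y 0 := by
      intro Y hY
      obtain ⟨b, -, rfl⟩ := List.mem_map.1 hY
      exact hP b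
    have hpow : ∀ {f : E → ℝ} (hf : VanishOrd 1 f) (n : ℕ), along (P c) (f ^ n) =ᶠ[𝓝 0]
        (n : ℝ) • (f ^ (n - 1) • along (P c) f) := by
      intro f hf n
      filter_upwards [hf.analyticAt.eventually_analyticAt] with p hp
      simp [along, fderiv_pow (𝕜 := ℝ) n hp.differentiableAt, mul_assoc]
    have hexp : along (P c) (s ^ a • y ^ b) =ᶠ[𝓝 0]
        ((a : ℝ) * along (P c) s 0) • (s ^ (a - 1) • y ^ b)
        + ((b : ℝ) * along (P c) y 0) • (s ^ a • y ^ (b - 1))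
        + ((a : ℝ) • ((s ^ (a - 1) • y ^ b) • (along (P c) s - fun _ => along (P c) s 0))
        + (b : ℝ) • ((s ^ a • y ^ (b - 1)) • (along (P c) y - fun _ => along (P c) y 0))) := by
      filter_upwards [along_smul_eventuallyEq (Y := P c) (hs.pow a).analyticAt (hy.pow b).analyticAt,
        hpow hs a, hpow hy b] with p h1 h2 h3
      rw [h1]
      simp only [Pi.add_apply, h2, h3, Pi.smul_apply, Pi.sub_apply, Pi.mul_apply,
        Pi.pow_apply, smul_eq_mul]
      ring
    have hrem : ∀ {f : E → ℝ} (hf : VanishOrd 1 f),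
        VanishOrd 1 (along (P c) f - fun _ => along (P c) f 0) := by
      intro f hf
      exact vanishOrd_one ((AnalyticAt.along (hP c) hf.analyticAt).sub analyticAt_const) (by simp)
    have hr1 : VanishOrd (a + b)
        ((a : ℝ) • ((s ^ (a - 1) • y ^ b) • (along (P c) s - fun _ => along (P c) s 0))) := by
      rcases Nat.eq_zero_or_pos a with h | h
      · subst h; simpa using vanishOrd_zero _
      · exact ((((hs.pow _).smul (hy.pow _) le_rfl).smul (hrem hs) (by omega))).const_smul _
    have hr2 : VanishOrd (a + b)
        ((b : ℝ) • ((s ^ a • y ^ (b - 1)) • (along (P c) y - fun _ => along (P c) y 0))) := by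
      rcases Nat.eq_zero_or_pos b with h | h
      · subst h; simpa using vanishOrd_zero _
      · exact ((((hs.pow _).smul (hy.pow _) le_rfl).smul (hrem hy) (by omega))).const_smul _
    have hm : ∀ i j : ℕ, AnalyticAt ℝ (s ^ i • y ^ j) 0 := fun i j =>
      (hs.pow i).analyticAt.smul (hy.pow j).analyticAt
    have hval : alongs ((l ++ [c]).map P) (s ^ a • y ^ b) 0
        = a * along (P c) s 0 * alongs (l.map P) (s ^ (a - 1) • y ^ b) 0
        + b * along (P c) y 0 * alongs (l.map P) (s ^ a • y ^ (b - 1)) 0 := by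
      rw [List.map_append, alongs_append]
      change alongs (l.map P) (along (P c) (s ^ a • y ^ b)) 0 = _
      rw [(hexp.alongs _).eq_of_nhds,
        (alongs_add_eventuallyEq hl' (((hm _ _).const_smul).add ((hm _ _).const_smul))
          (hr1.add hr2).analyticAt).eq_of_nhds, Pi.add_apply,
        (hr1.add hr2).alongs_apply_zero hl' (by simp; omega), add_zero,
        (alongs_add_eventuallyEq hl' (hm _ _).const_smul (hm _ _).const_smul).eq_of_nhds,
        alongs_const_smul, alongs_const_smul]
      simp
    rw [hval]
    cases c with
    | true =>
      rw [hst, hyt]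
      rcases Nat.eq_zero_or_pos a with h | h
      · subst h; simp
      · obtain ⟨a, rfl⟩ : ∃ a', a = a' + 1 := ⟨a - 1, by omega⟩
        rw [ih (a + 1 - 1) b (by omega)]
        simp only [Nat.add_sub_cancel, List.count_append, List.count_singleton_self,
          Nat.add_right_cancel_iff, Nat.factorial_succ]
        split_ifs <;> push_cast <;> ring
    | false =>
      rw [hsf, hyf]
      rcases Nat.eq_zero_or_pos b with h | h
      · subst h
        have : List.count true l ≤ l.length := List.count_le_length
        rw [if_neg (by simp; omega)]
        simp
      · obtain ⟨b, rfl⟩ : ∃ b', b = b' + 1 := ⟨b - 1, by omega⟩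
        rw [ih a (b + 1 - 1) (by omega)]
        simp only [Nat.add_sub_cancel, List.count_append, Nat.factorial_succ]
        simp
        split_ifs <;> ring

end VanishingOrder

section LieWords

open Filter

set_option linter.unusedSectionVars false

variable {E : Type*} [NormedAddCommGroup E] [NormedSpace ℝ E] [CompleteSpace E]

lemma AnalyticAt.lieVF {Y Z : E → E} {p : E} (hY : AnalyticAt ℝ Y p) (hZ : AnalyticAt ℝ Z p) :
    AnalyticAt ℝ (lieVF Y Z) p :=
  (AnalyticAt.along hY hZ).sub (AnalyticAt.along hZ hY)

lemma Filter.EventuallyEq.lieVF {Y Y' Z Z' : E → E} (hY : Y =ᶠ[𝓝 0] Y') (hZ : Z =ᶠ[𝓝 0] Z') :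
    lieVF Y Z =ᶠ[𝓝 0] lieVF Y' Z' := by
  filter_upwards [hY, hZ, hY.fderiv (𝕜 := ℝ), hZ.fderiv (𝕜 := ℝ)] with p h1 h2 h3 h4
  simp [_root_.lieVF, h1, h2, h3, h4]

lemma lieVF_swap (Y Z : E → E) : lieVF Y Z = -lieVF Z Y := by
  ext p
  simp [lieVF]

lemma lieVF_self (Y : E → E) : lieVF Y Y = 0 := by
  ext p
  simp [lieVF]

lemma lieVF_zero (Y : E → E) : lieVF Y 0 = 0 := by
  ext p
  simp [lieVF]

lemma lieVF_neg (Y Z : E → E) : lieVF Y (-Z) = -lieVF Y Z := by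
  ext p
  simp [lieVF, fderiv_neg]
  abel

lemma lieVF_add_eventuallyEq {Y Z Z' : E → E} (hZ : AnalyticAt ℝ Z 0) (hZ' : AnalyticAt ℝ Z' 0) :
    lieVF Y (Z + Z') =ᶠ[𝓝 0] lieVF Y Z + lieVF Y Z' := by
  filter_upwards [hZ.eventually_analyticAt, hZ'.eventually_analyticAt] with p h h'
  simp [lieVF, fderiv_add h.differentiableAt h'.differentiableAt]
  abel

lemma lieVF_sub_eventuallyEq {Y Z Z' : E → E} (hZ : AnalyticAt ℝ Z 0) (hZ' : AnalyticAt ℝ Z' 0) :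
    lieVF Y (Z - Z') =ᶠ[𝓝 0] lieVF Y Z - lieVF Y Z' := by
  simpa [sub_eq_add_neg, lieVF_neg] using lieVF_add_eventuallyEq (Y := Y) hZ hZ'.neg

lemma lieVF_smul_eventuallyEq {Y Z : E → E} {f : E → ℝ} (hf : AnalyticAt ℝ f 0)
    (hZ : AnalyticAt ℝ Z 0) :
    lieVF Y (f • Z) =ᶠ[𝓝 0] f • lieVF Y Z + along Y f • Z := by
  filter_upwards [along_smul_eventuallyEq (Y := Y) hf hZ] with p h
  change along Y (f • Z) p - fderiv ℝ Y p (f p • Z p) = _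
  rw [h]
  simp only [Pi.add_apply, Pi.smul_apply', lieVF, along, map_smul, smul_sub]
  abel

lemma lieVF_jacobi_eventuallyEq {Y Z W : E → E} (hY : AnalyticAt ℝ Y 0) (hZ : AnalyticAt ℝ Z 0)
    (hW : AnalyticAt ℝ W 0) :
    lieVF Y (lieVF Z W) =ᶠ[𝓝 0] lieVF (lieVF Y Z) W + lieVF Z (lieVF Y W) := by
  filter_upwards [hY.eventually_analyticAt, hZ.eventually_analyticAt,
    hW.eventually_analyticAt] with p h1 h2 h3
  exact VectorField.leibniz_identity_lieBracket (n := ω) le_top h1.contDiffAt h2.contDiffAt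
    h3.contDiffAt

lemma VanishOrd.along_left {F : Type*} [NormedAddCommGroup F] [NormedSpace ℝ F] [CompleteSpace F]
    {k : ℕ} {Y : E → E} {g : E → F} (hY : VanishOrd k Y) (hg : AnalyticAt ℝ g 0) :
    VanishOrd k (_root_.along Y g) :=
  VanishOrd.clm_eval (i := 0) (A := fderiv ℝ g) hg.fderiv hY (by omega)

lemma nestedLie_append (L L' : List (E → E)) (Z : E → E) :
    nestedLie (L ++ L') Z = nestedLie L (nestedLie L' Z) := by
  induction L with
  | nil => rfl
  | cons Y L ih => simp [nestedLie, ih]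

lemma nestedLie_zero (L : List (E → E)) : nestedLie L 0 = 0 := by
  induction L with
  | nil => rfl
  | cons Y L ih => simp [nestedLie, ih, lieVF_zero]

lemma nestedLie_neg (L : List (E → E)) (Z : E → E) : nestedLie L (-Z) = -nestedLie L Z := by
  induction L with
  | nil => rfl
  | cons Y L ih => simp [nestedLie, ih, lieVF_neg]

lemma AnalyticAt.nestedLie {L : List (E → E)} (hL : ∀ Y ∈ L, AnalyticAt ℝ Y 0) {Z : E → E}
    (hZ : AnalyticAt ℝ Z 0) : AnalyticAt ℝ (nestedLie L Z) 0 := by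
  induction L with
  | nil => exact hZ
  | cons Y L ih =>
    rw [List.forall_mem_cons] at hL
    exact AnalyticAt.lieVF hL.1 (ih hL.2)

lemma forall_mem_map_analyticAt {P : Bool → E → E} (hP : ∀ b, AnalyticAt ℝ (P b) 0)
    (l : List Bool) : ∀ Y ∈ l.map P, AnalyticAt ℝ Y 0 := by
  intro Y hY
  obtain ⟨b, -, rfl⟩ := List.mem_map.1 hY
  exact hP b

/-- Perturbing the letters of an iterated bracket to order `k` and its last entry to order `k - 1`
changes it, to leading order, only through the derivatives of the last entry. -/
lemma vanishOrd_nestedLie_sub {k : ℕ} {P P' : Bool → E → E} {Z Z' : E → E}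
    (hP : ∀ b, AnalyticAt ℝ (P b) 0) (hP' : ∀ b, AnalyticAt ℝ (P' b) 0)
    (hPP' : ∀ b, VanishOrd k (P' b - P b)) (hZ : AnalyticAt ℝ Z 0) (hZ' : AnalyticAt ℝ Z' 0)
    (hZZ' : VanishOrd (k - 1) (Z' - Z)) (l : List Bool) :
    VanishOrd (k - l.length) (nestedLie (l.map P') Z' - nestedLie (l.map P) Z
      - alongs (l.map P) (Z' - Z)) := by
  induction l with
  | nil => simpa [nestedLie, alongs] using vanishOrd_zero k
  | cons b l ih =>
    have hl := forall_mem_map_analyticAt hP l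
    have hA := hZZ'.alongs hl
    simp only [List.length_map] at hA
    have hB := hZ.nestedLie hl
    have hB' := hZ'.nestedLie (forall_mem_map_analyticAt hP' l)
    simp only [List.map_cons, nestedLie, alongs, List.length_cons]
    set A := alongs (l.map P) (Z' - Z)
    set B := nestedLie (l.map P) Z
    set B' := nestedLie (l.map P') Z'
    have hBB' : VanishOrd (k - (l.length + 1)) (B' - B) := by
      have := (ih.mono (m := k - (l.length + 1)) (by omega)).add (hA.mono (by omega))
      simpa using this
    have h1 : VanishOrd (k - (l.length + 1)) (along (P' b - P b) B') :=
      ((hPP' b).along_left hB').mono (by omega)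
    have h2 : VanishOrd (k - (l.length + 1)) (along (P b) (B' - B - A)) :=
      (ih.along (hP b)).mono (by omega)
    have h3 : VanishOrd (k - (l.length + 1)) (along B' (P' b - P b)) :=
      ((hPP' b).along hB').mono (by omega)
    have h4 : VanishOrd (k - (l.length + 1)) (along (B' - B) (P b)) := hBB'.along_left (hP b)
    refine (((h1.add h2).sub h3).sub h4).congr ?_
    filter_upwards [hB.eventually_analyticAt, hB'.eventually_analyticAt,
      hA.analyticAt.eventually_analyticAt, (hP b).eventually_analyticAt,
      (hP' b).eventually_analyticAt] with p h5 h6 h7 h8 h9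
    simp only [along, lieVF, Pi.add_apply, Pi.sub_apply,
      fderiv_sub (h6.differentiableAt.sub h5.differentiableAt) h7.differentiableAt,
      fderiv_sub h6.differentiableAt h5.differentiableAt,
      fderiv_sub h9.differentiableAt h8.differentiableAt, map_sub, sub_apply]
    abel

/-- `Z` is analytic at `0` and all its iterated brackets with fewer than `m` letters from `P`
vanish at `0`. -/
def Flat (P : Bool → E → E) : ℕ → (E → E) → Prop
  | 0, Z => AnalyticAt ℝ Z 0
  | m + 1, Z => AnalyticAt ℝ Z 0 ∧ Z 0 = 0 ∧ ∀ b, Flat P m (lieVF (P b) Z)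

variable {P : Bool → E → E} {m : ℕ} {Y Z : E → E}

lemma Flat.analyticAt (h : Flat P m Z) : AnalyticAt ℝ Z 0 := by
  cases m with
  | zero => exact h
  | succ m => exact h.1

lemma Flat.congr (h : Flat P m Y) (he : Y =ᶠ[𝓝 0] Z) : Flat P m Z := by
  induction m generalizing Y Z with
  | zero => exact AnalyticAt.congr h he
  | succ m ih =>
    exact ⟨h.1.congr he, he.eq_of_nhds ▸ h.2.1,
      fun b => ih (h.2.2 b) ((EventuallyEq.refl _ _).lieVF he)⟩

lemma Flat.neg (h : Flat P m Z) : Flat P m (-Z) := by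
  induction m generalizing Z with
  | zero => exact AnalyticAt.neg h
  | succ m ih =>
    exact ⟨h.1.neg, by simp [h.2.1], fun b => lieVF_neg (P b) Z ▸ ih (h.2.2 b)⟩

lemma Flat.add (h : Flat P m Y) (h' : Flat P m Z) : Flat P m (Y + Z) := by
  induction m generalizing Y Z with
  | zero => exact AnalyticAt.add h h'
  | succ m ih =>
    exact ⟨h.1.add h'.1, by simp [h.2.1, h'.2.1], fun b =>
      (ih (h.2.2 b) (h'.2.2 b)).congr (lieVF_add_eventuallyEq h.1 h'.1).symm⟩

lemma flat_zero (P : Bool → E → E) (m : ℕ) : Flat P m 0 := by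
  induction m with
  | zero => exact analyticAt_const
  | succ m ih => exact ⟨analyticAt_const, rfl, fun b => (lieVF_zero (P b)).symm ▸ ih⟩

lemma Flat.of_succ (h : Flat P (m + 1) Z) : Flat P m Z := by
  induction m generalizing Z with
  | zero => exact h.1
  | succ m ih => exact ⟨h.1, h.2.1, fun b => ih (h.2.2 b)⟩

lemma Flat.mono {m' : ℕ} (h : Flat P m Z) (hm : m' ≤ m) : Flat P m' Z := by
  induction m, hm using Nat.le_induction with
  | base => exact h
  | succ m _ ih => exact ih h.of_succ

lemma Flat.lieVF (hP : ∀ b, AnalyticAt ℝ (P b) 0) (hY : Flat P m Y) (hZ : Flat P m Z) :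
    Flat P m (lieVF Y Z) := by
  induction m generalizing Y Z with
  | zero => exact AnalyticAt.lieVF hY hZ
  | succ m ih =>
    refine ⟨AnalyticAt.lieVF hY.1 hZ.1, by simp [_root_.lieVF, hY.2.1, hZ.2.1], fun b => ?_⟩
    exact ((ih (hY.2.2 b) hZ.of_succ).add (ih hY.of_succ (hZ.2.2 b))).congr
      (lieVF_jacobi_eventuallyEq (hP b) hY.1 hZ.1).symm

lemma flat_of_nestedLie (hP : ∀ b, AnalyticAt ℝ (P b) 0) (hZ : AnalyticAt ℝ Z 0)
    (h : ∀ l : List Bool, l.length < m → nestedLie (l.map P) Z 0 = 0) : Flat P m Z := by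
  induction m generalizing Z with
  | zero => exact hZ
  | succ m ih =>
    refine ⟨hZ, h [] (by simp), fun b => ih (AnalyticAt.lieVF (hP b) hZ) fun l hl => ?_⟩
    have := h (l ++ [b]) (by simpa using hl)
    rwa [List.map_append, nestedLie_append] at this

lemma Flat.nestedLie {l : List Bool} (h : Flat P (m + l.length) Z) :
    Flat P m (nestedLie (l.map P) Z) := by
  induction l generalizing m with
  | nil => exact h
  | cons b l ih =>
    exact (ih (m := m + 1) (by rwa [List.length_cons, add_comm _ 1, ← add_assoc] at h)).2.2 b

lemma flat_nestedLie_sub_of_perm (hP : ∀ b, AnalyticAt ℝ (P b) 0) {N : ℕ}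
    (hK : Flat P N (lieVF (P true) (P false))) {l l' : List Bool} (hl : l.Perm l')
    (hm : m + l.length ≤ N + 1) :
    Flat P m (nestedLie (l.map P) (lieVF (P true) (P false)) -
      nestedLie (l'.map P) (lieVF (P true) (P false))) := by
  induction hl generalizing m with
  | nil => simpa using flat_zero P m
  | @cons x l₁ l₂ _ ih =>
    exact ((ih (m := m + 1) (by simp at hm; omega)).2.2 x).congr (lieVF_sub_eventuallyEq
      (hK.analyticAt.nestedLie (forall_mem_map_analyticAt hP _))
      (hK.analyticAt.nestedLie (forall_mem_map_analyticAt hP _)))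
  | swap x y l =>
    simp only [List.length_cons] at hm
    have hxy : Flat P m (lieVF (P y) (P x)) := by
      cases x <;> cases y
      · exact (lieVF_self (P false)).symm ▸ flat_zero P m
      · exact hK.mono (by omega)
      · exact lieVF_swap (P false) (P true) ▸ (hK.mono (by omega)).neg
      · exact (lieVF_self (P true)).symm ▸ flat_zero P m
    have hw : Flat P m (nestedLie (l.map P) (lieVF (P true) (P false))) :=
      (hK.mono (m' := m + l.length) (by omega)).nestedLie
    refine (hxy.lieVF hP hw).congr ?_
    filter_upwards [lieVF_jacobi_eventuallyEq (hP y) (hP x) hw.analyticAt] with p hp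
    simp [_root_.nestedLie, hp]
  | trans h₁ h₂ ih₁ ih₂ =>
    have := (ih₁ hm).add (ih₂ (h₁.length_eq ▸ hm))
    simpa using this

lemma nestedLie_apply_zero_eq_of_perm (hP : ∀ b, AnalyticAt ℝ (P b) 0) {l l' : List Bool}
    (hK : ∀ w : List Bool, w.length < l.length →
      nestedLie (w.map P) (lieVF (P true) (P false)) 0 = 0) (hl : l.Perm l') :
    nestedLie (l.map P) (lieVF (P true) (P false)) 0 =
      nestedLie (l'.map P) (lieVF (P true) (P false)) 0 := by
  have hflat := flat_of_nestedLie hP (AnalyticAt.lieVF (hP true) (hP false)) hK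
  have := (flat_nestedLie_sub_of_perm (m := 1) hP hflat hl (by omega)).2.1
  exact sub_eq_zero.1 this

lemma commutesAtOrder_of_nestedLie {J : E → E →L[ℝ] E} {X : E → E} {k : ℕ}
    (h : ∀ l : List Bool, l.length + 2 ≤ k →
      nestedLie (l.map (pickVF X (Jvf J X))) (lieVF X (Jvf J X)) 0 = 0) :
    CommutesAtOrder J X k 0 := by
  intro m hm hmk b c
  obtain ⟨m, rfl⟩ : ∃ m', m = m' + 1 := ⟨m - 1, by omega⟩
  have hw := h (List.ofFn fun i => b (Fin.castSucc i)) (by simp; omega)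
  rw [List.map_ofFn] at hw
  rw [List.ofFn_succ', List.concat_eq_append, nestedLie_append]
  change nestedLie (List.ofFn _) (lieVF (pickVF X (Jvf J X) (b (Fin.last m)))
    (pickVF X (Jvf J X) c)) 0 = 0
  rcases b (Fin.last m) <;> rcases c
  · rw [lieVF_self, nestedLie_zero]; rfl
  · change nestedLie (List.ofFn _) (lieVF (Jvf J X) X) 0 = 0
    rw [lieVF_swap, nestedLie_neg]
    exact neg_eq_zero.2 hw
  · exact hw
  · rw [lieVF_self, nestedLie_zero]; rfl

end LieWords

section Refinement

open Filter

set_option linter.unusedSectionVars false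

variable {E : Type*} [NormedAddCommGroup E] [NormedSpace ℝ E] [CompleteSpace E]

lemma lieVF_add_add_sub_eventuallyEq {A B a b : E → E} (hA : AnalyticAt ℝ A 0)
    (hB : AnalyticAt ℝ B 0) (ha : AnalyticAt ℝ a 0) (hb : AnalyticAt ℝ b 0) :
    lieVF (A + a) (B + b) - lieVF A B =ᶠ[𝓝 0] lieVF A b - lieVF B a + lieVF a b := by
  filter_upwards [hA.eventually_analyticAt, hB.eventually_analyticAt, ha.eventually_analyticAt,
    hb.eventually_analyticAt] with p h1 h2 h3 h4
  simp only [lieVF, Pi.add_apply, Pi.sub_apply, fderiv_add h1.differentiableAt h3.differentiableAt,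
    fderiv_add h2.differentiableAt h4.differentiableAt, map_add, add_apply]
  abel

lemma Jvf_add (J : E → E →L[ℝ] E) (Y Z : E → E) : Jvf J (Y + Z) = Jvf J Y + Jvf J Z := by
  ext p
  simp [Jvf]

lemma Jvf_smul (J : E → E →L[ℝ] E) (f : E → ℝ) (Y : E → E) : Jvf J (f • Y) = f • Jvf J Y := by
  ext p
  simp [Jvf]

lemma AnalyticAt.Jvf {J : E → E →L[ℝ] E} {Y : E → E} {p : E} (hJ : AnalyticAt ℝ J p)
    (hY : AnalyticAt ℝ Y p) : AnalyticAt ℝ (Jvf J Y) p :=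
  hJ.clm_eval hY

lemma analyticAt_pickVF {J : E → E →L[ℝ] E} {X : E → E} {p : E} (hJ : AnalyticAt ℝ J p)
    (hX : AnalyticAt ℝ X p) (b : Bool) : AnalyticAt ℝ (pickVF X (Jvf J X) b) p := by
  cases b
  · exact hJ.Jvf hX
  · exact hX

/-- The iterated bracket of `[X, JX]` along the letters `l`. -/
def lieWord (J : E → E →L[ℝ] E) (X : E → E) (l : List Bool) : E → E :=
  nestedLie (l.map (pickVF X (Jvf J X))) (lieVF X (Jvf J X))

lemma AnalyticAt.lieWord {J : E → E →L[ℝ] E} {X : E → E} (hJ : AnalyticAt ℝ J 0)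
    (hX : AnalyticAt ℝ X 0) (l : List Bool) : AnalyticAt ℝ (lieWord J X l) 0 :=
  (AnalyticAt.lieVF hX (hJ.Jvf hX)).nestedLie
    (forall_mem_map_analyticAt (analyticAt_pickVF hJ hX) l)

/-- The effect on iterated brackets of adding a multiple `f • W` to `X`, where `f` vanishes to
order `N + 1`. -/
lemma lieWord_add_smul_apply_zero {J : E → E →L[ℝ] E} {X W : E → E} {f : E → ℝ} {N : ℕ}
    (hJ : AnalyticAt ℝ J 0) (hX : AnalyticAt ℝ X 0) (hW : AnalyticAt ℝ W 0)
    (hf : VanishOrd (N + 1) f) (l : List Bool) (hl : l.length ≤ N) :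
    lieWord J (X + f • W) l 0 = lieWord J X l 0
      + (alongs ((l ++ [true]).map (pickVF X (Jvf J X))) f 0 • Jvf J W 0
      - alongs ((l ++ [false]).map (pickVF X (Jvf J X))) f 0 • W 0) := by
  set P := pickVF X (Jvf J X) with hPdef
  have hP : ∀ b, AnalyticAt ℝ (P b) 0 := analyticAt_pickVF hJ hX
  have hPl := forall_mem_map_analyticAt hP l
  have hJX := hJ.Jvf hX
  have hJW := hJ.Jvf hW
  have hfan := hf.analyticAt
  have hX' : AnalyticAt ℝ (X + f • W) 0 := hX.add (hfan.smul hW)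
  have hJX' : Jvf J (X + f • W) = Jvf J X + f • Jvf J W := by rw [Jvf_add, Jvf_smul]
  have hfW : VanishOrd (N + 1) (f • W) := hf.smul (j := 0) hW le_rfl
  have hfJW : VanishOrd (N + 1) (f • Jvf J W) := hf.smul (j := 0) hJW le_rfl
  have hPP' : ∀ b, VanishOrd (N + 1) (pickVF (X + f • W) (Jvf J (X + f • W)) b - P b) := by
    intro b
    cases b
    · simpa [hPdef, pickVF, hJX'] using hfJW
    · simpa [hPdef, pickVF] using hfW
  have hXf : VanishOrd N (along X f • Jvf J W) := (hf.along hX).smul (j := 0) hJW le_rfl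
  have hJXf : VanishOrd N (along (Jvf J X) f • W) := (hf.along hJX).smul (j := 0) hW le_rfl
  set Z := lieVF X (Jvf J X) with hZdef
  set Z' := lieVF (X + f • W) (Jvf J (X + f • W)) with hZ'def
  have hZ : AnalyticAt ℝ Z 0 := AnalyticAt.lieVF hX hJX
  have hZ' : AnalyticAt ℝ Z' 0 := AnalyticAt.lieVF hX' (hJ.Jvf hX')
  have hrem : VanishOrd (N + 1)
      (Z' - Z - (along X f • Jvf J W - along (Jvf J X) f • W)) := by
    have h1 : VanishOrd (N + 1) (f • lieVF X (Jvf J W)) :=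
      hf.smul (j := 0) (AnalyticAt.lieVF hX hJW) le_rfl
    have h2 : VanishOrd (N + 1) (f • lieVF (Jvf J X) W) :=
      hf.smul (j := 0) (AnalyticAt.lieVF hJX hW) le_rfl
    have h3 : VanishOrd (N + 1) (lieVF (f • W) (f • Jvf J W)) :=
      (hfW.along_left hfJW.analyticAt).sub (hfJW.along_left hfW.analyticAt)
    refine ((h1.sub h2).add h3).congr ?_
    filter_upwards [lieVF_add_add_sub_eventuallyEq hX hJX hfW.analyticAt hfJW.analyticAt,
      lieVF_smul_eventuallyEq (Y := X) hfan hJW,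
      lieVF_smul_eventuallyEq (Y := Jvf J X) hfan hW] with p e1 e2 e3
    rw [hZ'def, hJX', Pi.sub_apply, e1]
    simp only [Pi.add_apply, Pi.sub_apply, e2, e3]
    abel
  have hZZ' : VanishOrd N (Z' - Z) := by
    simpa using (hrem.of_succ).add (hXf.sub hJXf)
  have hmain := (vanishOrd_nestedLie_sub hP (analyticAt_pickVF hJ hX') hPP' hZ hZ'
    (by simpa using hZZ') l).apply_zero (by omega)
  have hrem0 := hrem.alongs_apply_zero hPl (by simp; omega)
  rw [(alongs_sub_eventuallyEq hPl hZZ'.analyticAt (hXf.sub hJXf).analyticAt).eq_of_nhds,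
    Pi.sub_apply, sub_eq_zero,
    (alongs_sub_eventuallyEq hPl hXf.analyticAt hJXf.analyticAt).eq_of_nhds, Pi.sub_apply,
    alongs_smul_apply_zero hPl ((hf.along hX).mono (by simp; omega)) hJW,
    alongs_smul_apply_zero hPl ((hf.along hJX).mono (by simp; omega)) hW] at hrem0
  rw [List.map_append, List.map_append, alongs_append, alongs_append]
  change lieWord J (X + f • W) l 0 - lieWord J X l 0 - _ = 0 at hmain
  rw [hrem0, sub_sub, sub_eq_zero] at hmain
  exact hmain

/-- Adding a suitable multiple of an iterated bracket of `X` to `X` kills the iterated brackets at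
`0` having `c + d` letters, `c` of which are equal to `X`. -/
lemma lieWord_refine {J : E → E →L[ℝ] E} {X : E → E} (hJ : AnalyticAt ℝ J 0)
    (hX : AnalyticAt ℝ X 0) {s y : E → ℝ} (hs : VanishOrd 1 s) (hy : VanishOrd 1 y)
    (hst : along X s 0 = 1) (hsf : along (Jvf J X) s 0 = 0)
    (hyt : along X y 0 = 0) (hyf : along (Jvf J X) y 0 = 1) (c d : ℕ)
    (hlt : ∀ l : List Bool, l.length < c + d → lieWord J X l 0 = 0)
    (hgt : ∀ l : List Bool, l.length = c + d → c < l.count true → lieWord J X l 0 = 0)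
    (l : List Bool) (hl : l.length < c + d ∨ l.length = c + d ∧ c ≤ l.count true) :
    lieWord J (X + ((c.factorial * (d + 1).factorial : ℝ)⁻¹ • (s ^ c • y ^ (d + 1))) •
      lieWord J X (List.replicate c true ++ List.replicate d false)) l 0 = 0 := by
  set f : E → ℝ := (c.factorial * (d + 1).factorial : ℝ)⁻¹ • (s ^ c • y ^ (d + 1)) with hfdef
  set w := List.replicate c true ++ List.replicate d false with hw
  have hP : ∀ b, AnalyticAt ℝ (pickVF X (Jvf J X) b) 0 := analyticAt_pickVF hJ hX
  have hf : VanishOrd (c + d + 1) f :=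
    ((hs.pow c).smul (hy.pow (d + 1)) (by omega)).const_smul _
  rw [lieWord_add_smul_apply_zero hJ hX (hJ.lieWord hX w) hf l (by omega)]
  rcases hl with hl | ⟨hl, hc⟩
  · rw [hf.alongs_apply_zero (forall_mem_map_analyticAt hP _) (by simp; omega),
      hf.alongs_apply_zero (forall_mem_map_analyticAt hP _) (by simp; omega), hlt l hl]
    simp
  · have hne : (c.factorial * (d + 1).factorial : ℝ) ≠ 0 := by positivity
    have hval : ∀ b, alongs ((l ++ [b]).map (pickVF X (Jvf J X))) f 0 =
        if (l ++ [b]).count true = c then 1 else 0 := by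
      intro b
      rw [hfdef, alongs_const_smul, Pi.smul_apply, alongs_monomial_apply_zero hP hs hy hst hsf hyt
        hyf _ c (d + 1) (by simp; omega)]
      split_ifs
      · rw [smul_eq_mul, inv_mul_cancel₀ hne]
      · simp
    rw [hval, hval, if_neg (by simp; omega), zero_smul, zero_sub]
    by_cases h : l.count true = c
    · have hperm : l.Perm w := by
        have hlen : l.count true + l.count false = l.length := by simp
        rw [List.perm_iff_count]
        rintro (_ | _)
        · simp [hw, List.count_replicate]; omega
        · simp [hw, List.count_replicate, h]
      have := nestedLie_apply_zero_eq_of_perm hP (l := l) (l' := w) (fun v hv => hlt v (by omega))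
        hperm
      rw [if_pos (by simpa using h), one_smul]
      exact add_neg_eq_zero.2 this
    · rw [if_neg (by simpa using h), hgt l hl (by omega)]
      simp

/-- The germs at `0` of vector fields in the module over the analytic functions generated by
`ℒ(X)`. -/
inductive LieSpan (J : E → E →L[ℝ] E) (X : E → E) : (E → E) → Prop
  | of {Y : E → E} : LieGen J X Y → LieSpan J X Y
  | smul {f : E → ℝ} {Y : E → E} : AnalyticAt ℝ f 0 → LieSpan J X Y → LieSpan J X (f • Y)
  | add {Y Z : E → E} : LieSpan J X Y → LieSpan J X Z → LieSpan J X (Y + Z)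
  | congr {Y Z : E → E} : LieSpan J X Y → Y =ᶠ[𝓝 0] Z → LieSpan J X Z

section LieSpan

variable {J : E → E →L[ℝ] E} {X Y Z : E → E}

lemma LieGen.analyticAt (hJ : AnalyticAt ℝ J 0) (hX : AnalyticAt ℝ X 0) (h : LieGen J X Y) :
    AnalyticAt ℝ Y 0 := by
  induction h with
  | base => exact hX
  | jmul _ ih => exact hJ.Jvf ih
  | bracket _ _ ih ih' => exact AnalyticAt.lieVF ih ih'

lemma LieSpan.analyticAt (hJ : AnalyticAt ℝ J 0) (hX : AnalyticAt ℝ X 0) (h : LieSpan J X Y) :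
    AnalyticAt ℝ Y 0 := by
  induction h with
  | of h => exact h.analyticAt hJ hX
  | smul hf _ ih => exact hf.smul ih
  | add _ _ ih ih' => exact ih.add ih'
  | congr _ he ih => exact ih.congr he

lemma LieSpan.neg (h : LieSpan J X Y) : LieSpan J X (-Y) := by
  have := h.smul (f := fun _ => -1) analyticAt_const
  exact this.congr (Eventually.of_forall fun p => by simp)

lemma LieSpan.Jvf (h : LieSpan J X Y) : LieSpan J X (Jvf J Y) := by
  induction h with
  | of h => exact .of h.jmul
  | smul hf _ ih => exact Jvf_smul J _ _ ▸ ih.smul hf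
  | add _ _ ih ih' => exact Jvf_add J _ _ ▸ ih.add ih'
  | congr _ he ih => exact ih.congr (he.mono fun p hp => by simp [_root_.Jvf, hp])

lemma LieSpan.lieVF_of_lieGen (hJ : AnalyticAt ℝ J 0) (hX : AnalyticAt ℝ X 0) (hY : LieGen J X Y)
    (hZ : LieSpan J X Z) : LieSpan J X (lieVF Y Z) := by
  induction hZ with
  | of h => exact .of (hY.bracket h)
  | smul hf h ih =>
    exact ((ih.smul hf).add (h.smul (AnalyticAt.along (hY.analyticAt hJ hX) hf))).congr
      (lieVF_smul_eventuallyEq hf (h.analyticAt hJ hX)).symm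
  | add h h' ih ih' =>
    exact (ih.add ih').congr
      (lieVF_add_eventuallyEq (h.analyticAt hJ hX) (h'.analyticAt hJ hX)).symm
  | congr _ he ih => exact ih.congr ((EventuallyEq.refl _ _).lieVF he)

lemma LieSpan.lieVF (hJ : AnalyticAt ℝ J 0) (hX : AnalyticAt ℝ X 0) (hY : LieSpan J X Y)
    (hZ : LieSpan J X Z) : LieSpan J X (lieVF Z Y) := by
  induction hY with
  | of h => exact lieVF_swap Z _ ▸ (hZ.lieVF_of_lieGen hJ hX h).neg
  | smul hf h ih =>
    exact ((ih.smul hf).add (h.smul (AnalyticAt.along (hZ.analyticAt hJ hX) hf))).congr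
      (lieVF_smul_eventuallyEq hf (h.analyticAt hJ hX)).symm
  | add h h' ih ih' =>
    exact (ih.add ih').congr
      (lieVF_add_eventuallyEq (h.analyticAt hJ hX) (h'.analyticAt hJ hX)).symm
  | congr _ he ih => exact ih.congr ((EventuallyEq.refl _ _).lieVF he)

lemma LieSpan.lieWord (hJ : AnalyticAt ℝ J 0) (hX : AnalyticAt ℝ X 0) (hY : LieSpan J X Y)
    (l : List Bool) : LieSpan J X (lieWord J Y l) := by
  induction l with
  | nil => exact hY.Jvf.lieVF hJ hX hY
  | cons b l ih =>
    refine ih.lieVF hJ hX ?_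
    cases b
    · exact hY.Jvf
    · exact hY

lemma LieSpan.eventually_tangent {φ : E → ℝ} {U : Set E} (hU : U ∈ 𝓝 0)
    (hφ : ∀ Y, LieGen J X Y → InTJM J φ U Y) (h : LieSpan J X Y) :
    ∀ᶠ q in 𝓝 0, φ q = 0 → fderiv ℝ φ q (Y q) = 0 ∧ fderiv ℝ φ q (J q (Y q)) = 0 := by
  induction h with
  | of h => filter_upwards [hU] with q hq using hφ _ h q hq
  | smul hf _ ih =>
    filter_upwards [ih] with q hq h0
    simp [hq h0]
  | add _ _ ih ih' =>
    filter_upwards [ih, ih'] with q hq hq' h0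
    simp [hq h0, hq' h0]
  | congr _ he ih =>
    filter_upwards [he, ih] with q hq hq' h0
    exact hq ▸ hq' h0

end LieSpan

/-- A vector field in the span of `ℒ(X)`, equal to `X` on a curve along which the transverse
coordinate `y` vanishes, whose iterated brackets vanish at `0` up to a given length. -/
lemma exists_lieSpan_lieWord_apply_zero {J : E → E →L[ℝ] E} {X : E → E} (hJ : AnalyticAt ℝ J 0)
    (hX : AnalyticAt ℝ X 0) {s y : E → ℝ} (hs : VanishOrd 1 s) (hy : VanishOrd 1 y)
    (hst : along X s 0 = 1) (hsf : along (Jvf J X) s 0 = 0)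
    (hyt : along X y 0 = 0) (hyf : along (Jvf J X) y 0 = 1) {γ : ℝ → E} (hγ0 : γ 0 = 0)
    (hyγ : ∀ᶠ t in 𝓝 0, y (γ t) = 0) (N : ℕ) :
    ∃ X', LieSpan J X X' ∧ (∀ᶠ t in 𝓝 0, X' (γ t) = X (γ t)) ∧
      ∀ l : List Bool, l.length < N → lieWord J X' l 0 = 0 := by
  induction N with
  | zero => exact ⟨X, .of .base, Eventually.of_forall fun _ => rfl, by simp⟩
  | succ N ih =>
    have key : ∀ j ≤ N + 1, ∃ X', LieSpan J X X' ∧ (∀ᶠ t in 𝓝 0, X' (γ t) = X (γ t)) ∧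
        (∀ l : List Bool, l.length < N → lieWord J X' l 0 = 0) ∧
        ∀ l : List Bool, l.length = N → N + 1 ≤ l.count true + j → lieWord J X' l 0 = 0 := by
      intro j
      induction j with
      | zero =>
        intro _
        obtain ⟨X', h1, h2, h3⟩ := ih
        refine ⟨X', h1, h2, h3, fun l hl hc => ?_⟩
        have : l.count true ≤ l.length := List.count_le_length
        omega
      | succ j ihj =>
        intro hj
        obtain ⟨X', h1, h2, h3, h4⟩ := ihj (by omega)
        obtain ⟨c, rfl⟩ : ∃ c, N = c + j := ⟨N - j, by omega⟩
        have hX' := h1.analyticAt hJ hX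
        have hX'0 : X' 0 = X 0 := by simpa [hγ0] using h2.self_of_nhds
        have hJX'0 : Jvf J X' 0 = Jvf J X 0 := by simp [Jvf, hX'0]
        have hrefine := lieWord_refine hJ hX' hs hy (by rw [along, hX'0]; exact hst)
          (by rw [along, hJX'0]; exact hsf) (by rw [along, hX'0]; exact hyt)
          (by rw [along, hJX'0]; exact hyf) c j h3 (fun l hl hc => h4 l hl (by omega))
        refine ⟨_, h1.add ((h1.lieWord hJ hX _).smul ?_), ?_,
          fun l hl => hrefine l (Or.inl hl), fun l hl hc => hrefine l (Or.inr ⟨hl, by omega⟩)⟩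
        · exact (((hs.pow c).smul (hy.pow (j + 1)) le_rfl).const_smul _).analyticAt
        · filter_upwards [h2, hyγ] with t ht hyt
          simp [ht, hyt]
    obtain ⟨X', h1, h2, h3, h4⟩ := key (N + 1) le_rfl
    refine ⟨X', h1, h2, fun l hl => ?_⟩
    rcases Nat.lt_succ_iff_lt_or_eq.1 hl with h | h
    · exact h3 l h
    · exact h4 l h (by omega)

/-- Vector fields that agree on an integral curve of one of them have the same iterated
derivatives along that curve. -/
lemma DX_apply_zero_eq_of_eq_on_curve {X X' : E → E} (hX : AnalyticAt ℝ X 0)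
    (hX' : AnalyticAt ℝ X' 0) {γ : ℝ → E} {c : ℝ → ℝ} (hγ0 : γ 0 = 0)
    (hc : ∀ᶠ t in 𝓝 0, c t ≠ 0) (hγ : ∀ᶠ t in 𝓝 0, HasDerivAt γ (c t • X (γ t)) t)
    (he : ∀ᶠ t in 𝓝 0, X' (γ t) = X (γ t)) (l : ℕ) : DX X' X' l 0 = DX X X l 0 := by
  have htend : Tendsto γ (𝓝 0) (𝓝 0) := by
    simpa [ContinuousAt, hγ0] using hγ.self_of_nhds.continuousAt
  have hzero : ∀ D : E → E, AnalyticAt ℝ D 0 → (∀ᶠ t in 𝓝 0, D (γ t) = 0) →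
      ∀ᶠ t in 𝓝 0, along X D (γ t) = 0 := by
    intro D hD hDγ
    filter_upwards [hDγ.eventually_nhds, hγ, hc, htend.eventually hD.eventually_analyticAt]
      with t h1 h2 h3 h4
    have h5 := h4.differentiableAt.hasFDerivAt.comp_hasDerivAt t h2
    have h6 : D ∘ γ =ᶠ[𝓝 t] fun _ => 0 := h1
    have h7 := (h5.congr_of_eventuallyEq h6.symm).unique (hasDerivAt_const t (0 : E))
    rw [map_smul] at h7
    exact (smul_eq_zero.1 h7).resolve_left h3
  have hDX : ∀ (Y : E → E), AnalyticAt ℝ Y 0 → ∀ l, AnalyticAt ℝ (DX Y Y l) 0 := by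
    intro Y hY l
    induction l with
    | zero => exact hY
    | succ l ih => exact AnalyticAt.along hY ih
  have hmain : ∀ᶠ t in 𝓝 0, DX X' X' l (γ t) - DX X X l (γ t) = 0 := by
    induction l with
    | zero => exact he.mono fun t ht => sub_eq_zero.2 ht
    | succ l ih =>
      filter_upwards [hzero _ ((hDX X' hX' l).sub (hDX X hX l)) ih, he,
        htend.eventually (hDX X hX l).eventually_analyticAt,
        htend.eventually (hDX X' hX' l).eventually_analyticAt] with t h1 h2 h3 h4
      simp only [along, fderiv_sub h4.differentiableAt h3.differentiableAt, sub_apply] at h1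
      simpa [DX, derVF, h2] using h1
  simpa [hγ0, sub_eq_zero] using hmain.self_of_nhds

/-- The main construction at a point where `X` and `JX` have dual real coordinates `σ`, `η`. -/
lemma exists_lieSpan_of_dual {J : E → E →L[ℝ] E} {X : E → E} (hJ : AnalyticAt ℝ J 0)
    (hX : AnalyticAt ℝ X 0) (σ η : E →L[ℝ] ℝ) (hσX : σ (X 0) = 1) (hσJX : σ (J 0 (X 0)) = 0)
    (hηX : η (X 0) = 0) (hηJX : η (J 0 (X 0)) = 1) (N : ℕ) :
    ∃ X', LieSpan J X X' ∧ (∀ l, DX X' X' l 0 = DX X X l 0) ∧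
      ∀ l : List Bool, l.length < N → lieWord J X' l 0 = 0 := by
  have hσan : AnalyticAt ℝ (fun z => σ (X z)) 0 := (σ.analyticAt _).comp hX
  have hY : AnalyticAt ℝ (fun z => (σ (X z))⁻¹ • X z) 0 :=
    (hσan.inv (by simp [hσX])).smul hX
  obtain ⟨γ, hγ0, hγ⟩ : ∃ γ : ℝ → E, γ 0 = 0 ∧
      ∀ᶠ t in 𝓝 0, HasDerivAt γ ((σ (X (γ t)))⁻¹ • X (γ t)) t := by
    obtain ⟨γ, hγ0, ε, hε, hγ⟩ :=
      hY.contDiffAt.exists_forall_mem_closedBall_exists_eq_forall_mem_Ioo_hasDerivAt₀ 0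
    exact ⟨γ, hγ0, eventually_of_mem (Ioo_mem_nhds (by linarith) (by linarith)) hγ⟩
  have hγan : AnalyticAt ℝ γ 0 := analyticAt_of_hasDerivAt_autonomous hY hγ0 hγ
  have htend : Tendsto γ (𝓝 0) (𝓝 0) := by
    simpa [ContinuousAt, hγ0] using hγan.continuousAt
  have hne : ∀ᶠ t in 𝓝 0, σ (X (γ t)) ≠ 0 :=
    htend.eventually (hσan.continuousAt.eventually_ne (by simp [hσX]))
  have hσγ : ∀ᶠ t in 𝓝 0, σ (γ t) = t := by
    obtain ⟨ε, hε, hball⟩ := Metric.eventually_nhds_iff_ball.1 (hγ.and hne)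
    have hder : ∀ t ∈ ball (0 : ℝ) ε, HasDerivAt (fun t => σ (γ t) - t) 0 t := by
      intro t ht
      have h : HasDerivAt (fun t => σ (γ t) - t) _ t :=
        (σ.hasFDerivAt.comp_hasDerivAt t (hball t ht).1).sub (hasDerivAt_id t)
      have hval : σ ((σ (X (γ t)))⁻¹ • X (γ t)) - 1 = 0 := by simp [(hball t ht).2]
      exact hval ▸ h
    refine eventually_of_mem (ball_mem_nhds 0 hε) fun t ht => ?_
    have h := isOpen_ball.is_const_of_deriv_eq_zero (convex_ball (0 : ℝ) ε).isPreconnected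
      (fun t ht => (hder t ht).differentiableAt.differentiableWithinAt)
      (fun t ht => (hder t ht).deriv) ht (mem_ball_self hε)
    simpa [hγ0, sub_eq_zero] using h
  have hσ0 : AnalyticAt ℝ (fun z => σ z) 0 := σ.analyticAt 0
  have hγσ : AnalyticAt ℝ (fun z => γ (σ z)) 0 := by
    refine AnalyticAt.comp (g := γ) (f := fun z => σ z) ?_ hσ0
    simpa using hγan
  have hyan : AnalyticAt ℝ (fun z => η (z - γ (σ z))) 0 :=
    (η.analyticAt _).comp (analyticAt_id.sub hγσ)
  have hyder : ∀ v, fderiv ℝ (fun z => η (z - γ (σ z))) 0 v = η v := by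
    intro v
    have h1 : HasDerivAt γ (X 0) (σ 0) := by simpa [hγ0, hσX] using hγ.self_of_nhds
    have h2 := h1.hasFDerivAt.comp (0 : E) σ.hasFDerivAt
    have h3 := (η.hasFDerivAt).comp (0 : E) ((hasFDerivAt_id (0 : E)).sub h2)
    have h4 : fderiv ℝ (fun z => η (z - γ (σ z))) 0 = _ := h3.fderiv
    rw [h4]
    simp [hηX]
  obtain ⟨X', h1, h2, h3⟩ := exists_lieSpan_lieWord_apply_zero hJ hX
    (vanishOrd_one hσ0 (map_zero σ)) (vanishOrd_one hyan (by simp [hγ0]))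
    (by simp [along, hσX]) (by simp [along, Jvf, hσJX])
    (by rw [along, hyder, hηX]) (by rw [along, hyder, Jvf, hηJX]) hγ0
    (hσγ.mono fun t ht => by simp [ht]) N
  exact ⟨X', h1, DX_apply_zero_eq_of_eq_on_curve hX (h1.analyticAt hJ hX) hγ0
    (hne.mono fun t ht => inv_ne_zero ht) hγ h2, h3⟩

/-- The real coordinates dual to `v`, `i v` in `ℂ^n`. -/
lemma exists_dual_coordinates {n : ℕ} {v : Ecx n} (hv : v ≠ 0) :
    ∃ σ η : Ecx n →L[ℝ] ℝ, σ v = 1 ∧ σ (Complex.I • v) = 0 ∧ η v = 0 ∧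
      η (Complex.I • v) = 1 := by
  have hv' : (‖v‖ ^ 2 : ℝ) ≠ 0 := by positivity
  refine ⟨(‖v‖ ^ 2)⁻¹ • Complex.reCLM.comp ((innerSL ℂ v).restrictScalars ℝ),
    (‖v‖ ^ 2)⁻¹ • Complex.imCLM.comp ((innerSL ℂ v).restrictScalars ℝ), ?_, ?_, ?_, ?_⟩ <;>
  simp [-Complex.ofReal_pow, ← Complex.ofReal_pow, hv]

lemma exists_analytic_modification {n : ℕ} {U : Set (Ecx n)} (hU : IsOpen U)
    (h0U : (0 : Ecx n) ∈ U) {J : Ecx n → Ecx n →L[ℝ] Ecx n} (hJ : AnalyticAt ℝ J 0)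
    (hJ0 : J 0 = J0 n) {φ : Ecx n → ℝ} {X : Ecx n → Ecx n} (hXan : AnalyticOnNhd ℝ X U)
    (hLie : ∀ Y, LieGen J X Y → InTJM J φ U Y) (k : ℕ) :
    ∃ (X' : Ecx n → Ecx n) (V : Set (Ecx n)),
      (IsOpen V ∧ (0 : Ecx n) ∈ V ∧ V ⊆ U ∧ AnalyticOnNhd ℝ X' V ∧ InTJM J φ V X') ∧
      (∀ l : ℕ, DX X' X' l 0 = DX X X l 0) ∧ CommutesAtOrder J X' k 0 := by
  have hX := hXan 0 h0U
  obtain ⟨X', hspan, hDX, hword⟩ : ∃ X', LieSpan J X X' ∧ (∀ l, DX X' X' l 0 = DX X X l 0) ∧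
      ∀ l : List Bool, l.length < k - 1 → lieWord J X' l 0 = 0 := by
    by_cases hX0 : X 0 = 0
    · have hDX : ∀ Y : Ecx n → Ecx n, Y 0 = 0 → ∀ l, DX Y Y l 0 = 0 := by
        rintro Y hY (_ | l)
        · exact hY
        · simp [DX, derVF, hY]
      refine ⟨0, (LieSpan.of .base).smul (f := 0) analyticAt_const |>.congr (by simp),
        fun l => by rw [hDX X hX0, hDX 0 rfl], fun l _ => ?_⟩
      have hJvf : Jvf J 0 = 0 := by
        ext1 p
        exact map_zero (J p)
      rw [lieWord, hJvf, lieVF_zero, nestedLie_zero]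
      rfl
    · obtain ⟨σ, η, h1, h2, h3, h4⟩ := exists_dual_coordinates hX0
      exact exists_lieSpan_of_dual hJ hX σ η h1 (by simpa [hJ0, J0] using h2) h3
        (by simpa [hJ0, J0] using h4) (k - 1)
  have hUn := hU.mem_nhds h0U
  obtain ⟨V, hV, hVo, h0V⟩ := _root_.mem_nhds_iff.1 (inter_mem hUn
    ((hspan.analyticAt hJ hX).eventually_analyticAt.and (hspan.eventually_tangent hUn hLie)))
  exact ⟨X', V, ⟨hVo, h0V, fun q hq => (hV hq).1, fun q hq => (hV hq).2.1,
    fun q hq => (hV hq).2.2⟩, hDX,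
    commutesAtOrder_of_nestedLie fun l hl => hword l (by omega)⟩

end Refinement

/-- Lemma 4.5, `pfreeman`. -/
theorem stmt17 (n : ℕ) (U : Set (Ecx n)) (hU : IsOpen U) (h0U : (0 : Ecx n) ∈ U)
    (J : Ecx n → Ecx n →L[ℝ] Ecx n) (hJan : AnalyticOnNhd ℝ J U)
    (hJsq : ∀ x ∈ U, (J x).comp (J x) = -ContinuousLinearMap.id ℝ (Ecx n))
    (hJ0 : J 0 = J0 n)
    (φ : Ecx n → ℝ) (hφan : AnalyticOnNhd ℝ φ U) (hφ0 : φ 0 = 0)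
    (hdφ : ∀ q ∈ U, φ q = 0 → fderiv ℝ φ q ≠ 0)
    (X : Ecx n → Ecx n) (hXan : AnalyticOnNhd ℝ X U)
    (hLie : ∀ Y, LieGen J X Y → InTJM J φ U Y) :
    ∃ (Xs : ℕ → Ecx n → Ecx n) (V : ℕ → Set (Ecx n)),
      (∀ k : ℕ, 1 ≤ k → IsOpen (V k) ∧ (0 : Ecx n) ∈ V k ∧ V k ⊆ U ∧
        AnalyticOnNhd ℝ (Xs k) (V k) ∧ InTJM J φ (V k) (Xs k)) ∧
      (∀ k : ℕ, 1 ≤ k → ∀ l : ℕ, DX (Xs k) (Xs k) l 0 = DX X X l 0) ∧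
      (∀ k : ℕ, 1 ≤ k → CommutesAtOrder J (Xs k) k 0) := by
  choose Xs V hV hDX hcomm using
    exists_analytic_modification hU h0U (hJan 0 h0U) hJ0 hXan hLie
  exact ⟨Xs, V, fun k _ => hV k, fun k _ => hDX k, fun k _ => hcomm k⟩
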